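/- For every 1 ≤ p ≤ n, the inverse Ñ_p : A²_{(p,0)}(ℂⁿ, e^{-|z|²}) → A²_{(p,0)}(ℂⁿ, e^{-|z|²}) of the complex Laplacian □̃_p = ∂*∂ + ∂∂* is a compact operator. -/

import Mathlib

open MeasureTheory Filter Complex Finset

noncomputable section

/-- Points of `ℂⁿ`. -/
abbrev Cn (n : ℕ) := Fin n → ℂ

/-- A form with coefficients indexed by subsets of `{1,…,n}`; a `(p,0)`-form
`Σ'_{|J|=p} u_J dz_J` is such a family supported on sets of cardinality `p`. -/
abbrev FormC (n : ℕ) := Finset (Fin n) → Cn n → ℂ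

/-- The Fock weight `e^{-|z|²}` on `ℂⁿ`. -/
def fWt {n : ℕ} (z : Cn n) : ℝ := Real.exp (-(∑ j, ‖z j‖ ^ 2))

/-- Squared Fock norm `‖f‖² = ∫ |f|² e^{-|z|²} dλ`. -/
def fNormSq {n : ℕ} (f : Cn n → ℂ) : ℝ := ∫ z : Cn n, ‖f z‖ ^ 2 * fWt z

/-- Fock inner product `(f,g) = ∫ f ḡ e^{-|z|²} dλ`. -/
def fInner {n : ℕ} (f g : Cn n → ℂ) : ℂ :=
  ∫ z : Cn n, f z * (starRingEnd ℂ) (g z) * fWt z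

/-- Membership in the Fock space `A²(ℂⁿ, e^{-|z|²})`. -/
def MemF {n : ℕ} (f : Cn n → ℂ) : Prop :=
  Differentiable ℂ f ∧ Integrable (fun z : Cn n => ‖f z‖ ^ 2 * fWt z)

/-- The holomorphic partial derivative `∂f/∂z_j`. -/
def pdz {n : ℕ} (j : Fin n) (f : Cn n → ℂ) : Cn n → ℂ :=
  fun z => fderiv ℂ f z (Pi.single j 1)

/-- The sign `(-1)^{#{i ∈ J : i < j}}` arising from `dz_j ∧ dz_J`. -/
def sgn {n : ℕ} (j : Fin n) (J : Finset (Fin n)) : ℂ :=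
  (-1 : ℂ) ^ (J.filter (fun i => i < j)).card

/-- The operator `∂`: `(∂u)_L = Σ_{j ∈ L} ± ∂u_{L\{j}}/∂z_j`, i.e.
`∂u = Σ'_J Σ_j (∂u_J/∂z_j) dz_j ∧ dz_J`. -/
def dOp {n : ℕ} (u : FormC n) : FormC n :=
  fun L z => ∑ j ∈ L, sgn j (L.erase j) * pdz j (u (L.erase j)) z

/-- The adjoint `∂*`: `(∂*u)_K = Σ_{j ∉ K} ± z_j u_{K ∪ {j}}`, i.e.
`∂*u = Σ'_K Σ_j z_j u_{jK} dz_K` on the Fock space. -/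
def dStarOp {n : ℕ} (u : FormC n) : FormC n :=
  fun K z => ∑ j ∈ Kᶜ, sgn j K * (z j * u (insert j K) z)

/-- The complex Laplacian `□̃ = ∂*∂ + ∂∂*`. -/
def boxOp {n : ℕ} (u : FormC n) : FormC n :=
  fun J z => dStarOp (dOp u) J z + dOp (dStarOp u) J z

/-- All coefficients belong to the Fock space. -/
def MemA2 {n : ℕ} (u : FormC n) : Prop := ∀ J, MemF (u J)

/-- `u` is a `(p,0)`-form: only coefficients with `|J| = p` may be nonzero. -/
def IsDeg {n : ℕ} (p : ℕ) (u : FormC n) : Prop :=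
  ∀ J : Finset (Fin n), J.card ≠ p → u J = 0

/-- Squared norm of a form: `Σ'_J ‖u_J‖²`. -/
def formNormSq {n : ℕ} (u : FormC n) : ℝ := ∑ J : Finset (Fin n), fNormSq (u J)

/-- Inner product of forms: `Σ'_J (u_J, v_J)`. -/
def formInner {n : ℕ} (u v : FormC n) : ℂ := ∑ J : Finset (Fin n), fInner (u J) (v J)

/-- `u ∈ dom ∂`. -/
def domD {n : ℕ} (u : FormC n) : Prop := MemA2 u ∧ MemA2 (dOp u)

/-- `u ∈ dom ∂*`. -/
def domDs {n : ℕ} (u : FormC n) : Prop := MemA2 u ∧ MemA2 (dStarOp u)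

/-- `u ∈ dom □̃`: `u ∈ dom ∂ ∩ dom ∂*`, `∂u ∈ dom ∂*` and `∂*u ∈ dom ∂`. -/
def domBox {n : ℕ} (u : FormC n) : Prop :=
  domD u ∧ domDs u ∧ domDs (dOp u) ∧ domD (dStarOp u)

/-- `N` is the bounded inverse `Ñ_p` of `□̃_p` on `A²_{(p,0)}(ℂⁿ, e^{-|z|²})`:
for `v ∈ A²_{(p,0)}`, `N v` is the unique element of `dom □̃_p` with
`□̃_p (N v) = v`. -/
def IsInvBox {n : ℕ} (p : ℕ) (N : FormC n → FormC n) : Prop :=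
  ∀ v : FormC n, IsDeg p v → MemA2 v →
    (IsDeg p (N v) ∧ domBox (N v) ∧ boxOp (N v) = v) ∧
    (∀ u : FormC n, IsDeg p u → domBox u → boxOp u = v → N v = u)

lemma sgn_insert {n : ℕ} {j k : Fin n} {K : Finset (Fin n)} (hk : k ∉ K) :
    sgn j (insert k K) = if k < j then -sgn j K else sgn j K := by
  unfold sgn
  rw [Finset.filter_insert]
  split_ifs with h
  · rw [Finset.card_insert_of_notMem (by simp [hk]), pow_succ]
    ring
  · rfl

lemma sgn_mul_self {n : ℕ} (j : Fin n) (J : Finset (Fin n)) : sgn j J * sgn j J = 1 := by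
  rw [sgn, ← pow_add, ← two_mul, pow_mul]
  simp

lemma sgn_mul_sgn_swap {n : ℕ} {j k : Fin n} {J : Finset (Fin n)} (hj : j ∉ J) (hk : k ∈ J) :
    sgn j J * sgn k ((insert j J).erase k) = -(sgn k (J.erase k) * sgn j (J.erase k)) := by
  have hjk : j ≠ k := fun h => hj (h ▸ hk)
  have h1 : sgn j J = sgn j (insert k (J.erase k)) := by rw [Finset.insert_erase hk]
  rw [h1, Finset.erase_insert_of_ne hjk, sgn_insert (by simp), sgn_insert (by simp [hj])]
  rcases lt_or_gt_of_ne hjk with h | h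
  · rw [if_neg h.not_gt, if_pos h]; ring
  · rw [if_pos h, if_neg h.not_gt]; ring

lemma pdz_coord_mul {n : ℕ} (j k : Fin n) {f : Cn n → ℂ} (hf : Differentiable ℂ f) (z : Cn n) :
    pdz k (fun y => y j * f y) z = (if j = k then f z else 0) + z j * pdz k f z := by
  unfold pdz
  have h1 : HasFDerivAt (fun y : Cn n => y j) (ContinuousLinearMap.proj (R := ℂ) j) z :=
    (ContinuousLinearMap.proj (R := ℂ) (φ := fun _ : Fin n => ℂ) j).hasFDerivAt
  have h2 : HasFDerivAt (fun y : Cn n => y j * f y) _ z := h1.mul (hf z).hasFDerivAt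
  rw [h2.fderiv]
  by_cases h : j = k
  · subst h; simp; ring
  · simp [h]

lemma pdz_dStarOp {n : ℕ} {u : FormC n} (hu : ∀ J, Differentiable ℂ (u J)) (k : Fin n)
    (K : Finset (Fin n)) (z : Cn n) :
    pdz k (dStarOp u K) z = ∑ j ∈ Kᶜ, sgn j K *
      ((if j = k then u (insert j K) z else 0) + z j * pdz k (u (insert j K)) z) := by
  have hd (j : Fin n) : Differentiable ℂ (fun y : Cn n => y j * u (insert j K) y) :=
    (differentiable_apply j).mul (hu _)
  have : dStarOp u K = fun y => ∑ j ∈ Kᶜ, sgn j K * (y j * u (insert j K) y) := rfl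
  rw [this]
  unfold pdz
  rw [fderiv_fun_sum (fun j _ => ((hd j).const_mul _) z)]
  rw [_root_.sum_apply]
  refine Finset.sum_congr rfl fun j _ => ?_
  rw [fderiv_const_mul ((hd j) z)]
  exact congrArg (sgn j K * ·) (pdz_coord_mul j k (hu _) z)

/-- Cartan's formula: on a coefficient `u_J`, the complex Laplacian is the Euler operator
plus `|J|`. -/
lemma boxOp_apply {n : ℕ} {u : FormC n} (hu : ∀ J, Differentiable ℂ (u J))
    (J : Finset (Fin n)) (z : Cn n) :
    boxOp u J z = fderiv ℂ (u J) z z + J.card * u J z := by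
  have hE : fderiv ℂ (u J) z z = ∑ j, z j * pdz j (u J) z := by
    conv_lhs => arg 2; rw [← Finset.univ_sum_single z]
    rw [map_sum]
    refine Finset.sum_congr rfl fun j _ => ?_
    have : (Pi.single j (z j) : Cn n) = z j • Pi.single j (1 : ℂ) := by
      rw [← Pi.single_smul]; simp
    rw [this, map_smul, smul_eq_mul]
    rfl
  have h1 : dStarOp (dOp u) J z = ∑ j ∈ Jᶜ, (z j * pdz j (u J) z +
      ∑ k ∈ J, -(sgn k (J.erase k) * sgn j (J.erase k) *
        (z j * pdz k (u (insert j (J.erase k))) z))) := by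
    refine Finset.sum_congr rfl fun j hj => ?_
    have hj : j ∉ J := by simpa using hj
    unfold dOp
    rw [Finset.sum_insert hj, Finset.erase_insert hj, mul_add, mul_add, Finset.mul_sum,
      Finset.mul_sum]
    congr 1
    · linear_combination (z j * pdz j (u J) z) * sgn_mul_self j J
    · refine Finset.sum_congr rfl fun k hk => ?_
      have hjk : j ≠ k := fun h => hj (h ▸ hk)
      have h := sgn_mul_sgn_swap hj hk
      rw [Finset.erase_insert_of_ne hjk] at h ⊢
      linear_combination (z j * pdz k (u (insert j (J.erase k))) z) * h
  have h2 : dOp (dStarOp u) J z = ∑ k ∈ J, (u J z + z k * pdz k (u J) z +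
      ∑ j ∈ Jᶜ, sgn k (J.erase k) * sgn j (J.erase k) *
        (z j * pdz k (u (insert j (J.erase k))) z)) := by
    refine Finset.sum_congr rfl fun k hk => ?_
    have hc : (J.erase k)ᶜ = insert k Jᶜ := by
      ext i; by_cases h : i = k <;> simp [h]
    rw [pdz_dStarOp hu, hc, Finset.sum_insert (by simpa using hk), mul_add, Finset.mul_sum,
      Finset.insert_erase hk, if_pos rfl]
    congr 1
    · linear_combination (u J z + z k * pdz k (u J) z) * sgn_mul_self k (J.erase k)
    · refine Finset.sum_congr rfl fun j hj => ?_
      have hjk : j ≠ k := fun h => by simp [h, hk] at hj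
      rw [if_neg hjk]; ring
  have hs : ∑ j, z j * pdz j (u J) z =
      ∑ j ∈ J, z j * pdz j (u J) z + ∑ j ∈ Jᶜ, z j * pdz j (u J) z :=
    (Finset.sum_add_sum_compl J _).symm
  unfold boxOp
  rw [h1, h2, hE, hs]
  simp only [Finset.sum_add_distrib, Finset.sum_neg_distrib, Finset.sum_const, nsmul_eq_mul]
  rw [Finset.sum_comm (s := Jᶜ)]
  ring

lemma enorm_integral_sq_le_lintegral {α : Type*} [MeasurableSpace α] {μ : Measure α}
    [IsProbabilityMeasure μ] {f : α → ℂ} (hf : AEStronglyMeasurable f μ) :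
    ‖∫ x, f x ∂μ‖ₑ ^ 2 ≤ ∫⁻ x, ‖f x‖ₑ ^ 2 ∂μ := by
  have h1 : ‖∫ x, f x ∂μ‖ₑ ≤ eLpNorm f 2 μ := by
    refine (enorm_integral_le_lintegral_enorm f).trans ?_
    rw [← eLpNorm_one_eq_lintegral_enorm]
    exact eLpNorm_le_eLpNorm_of_exponent_le (by norm_num) hf
  calc ‖∫ x, f x ∂μ‖ₑ ^ 2 ≤ eLpNorm f 2 μ ^ 2 := by gcongr
    _ = ∫⁻ x, ‖f x‖ₑ ^ 2 ∂μ := by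
      have := eLpNorm_nnreal_pow_eq_lintegral (μ := μ) (f := f) (p := 2) (by norm_num)
      simpa using this

/-- A solution of `(E + p) f = g`, `E` the Euler operator, is a weighted radial average of `g`. -/
lemma eq_integral_of_euler {n p : ℕ} (hp : 1 ≤ p) {f g : Cn n → ℂ} (hf : Differentiable ℂ f)
    (hg : Continuous g) (hfg : ∀ z, fderiv ℂ f z z + p * f z = g z) (z : Cn n) :
    f z = ∫ t in (0 : ℝ)..1, (t : ℂ) ^ (p - 1) * g ((t : ℂ) • z) := by
  have hd : ∀ t ∈ Set.uIcc (0 : ℝ) 1, HasDerivAt (fun t : ℝ => (t : ℂ) ^ p * f ((t : ℂ) • z))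
      ((t : ℂ) ^ (p - 1) * g ((t : ℂ) • z)) t := by
    intro t _
    have h1 : HasDerivAt (fun s : ℂ => s ^ p * f (s • z))
        (p * (t : ℂ) ^ (p - 1) * f ((t : ℂ) • z) +
          (t : ℂ) ^ p * fderiv ℂ f ((t : ℂ) • z) z) (t : ℂ) := by
      refine (hasDerivAt_pow p (t : ℂ)).mul ?_
      have h2 : HasDerivAt (fun s : ℂ => s • z) z (t : ℂ) := by
        simpa using (hasDerivAt_id (t : ℂ)).smul_const z
      exact (hf _).hasFDerivAt.comp_hasDerivAt (t : ℂ) h2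
    convert h1.comp_ofReal using 1
    rw [← hfg, map_smul, smul_eq_mul]
    obtain ⟨q, rfl⟩ : ∃ q, p = q + 1 := ⟨p - 1, by omega⟩
    simp only [Nat.add_sub_cancel, pow_succ]
    ring
  rw [intervalIntegral.integral_eq_sub_of_hasDerivAt hd]
  · simp [show p ≠ 0 by omega]
  · apply Continuous.intervalIntegrable
    fun_prop

lemma enorm_sq_le_lintegral_of_euler {n p : ℕ} (hp : 1 ≤ p) {f g : Cn n → ℂ}
    (hf : Differentiable ℂ f) (hg : Continuous g)
    (hfg : ∀ z, fderiv ℂ f z z + p * f z = g z) (z : Cn n) :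
    ‖f z‖ₑ ^ 2 ≤ ∫⁻ t in Set.Ioo (0 : ℝ) 1, ‖g ((t : ℂ) • z)‖ₑ ^ 2 := by
  have : IsProbabilityMeasure (volume.restrict (Set.Ioo (0 : ℝ) 1)) := ⟨by simp⟩
  rw [eq_integral_of_euler hp hf hg hfg z, intervalIntegral.integral_of_le zero_le_one,
    integral_Ioc_eq_integral_Ioo]
  refine (enorm_integral_sq_le_lintegral (by fun_prop)).trans ?_
  refine setLIntegral_mono' measurableSet_Ioo fun t ht => ?_
  gcongr
  rw [enorm_mul]
  refine mul_le_of_le_one_left zero_le ?_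
  rw [← ofReal_norm, ENNReal.ofReal_le_one, norm_pow, Complex.norm_real,
    Real.norm_of_nonneg ht.1.le]
  exact pow_le_one₀ ht.1.le ht.2.le

lemma continuous_fWt {n : ℕ} : Continuous (fWt : Cn n → ℝ) := by
  unfold fWt
  fun_prop

lemma fWt_pos {n : ℕ} (z : Cn n) : 0 < fWt z := Real.exp_pos _

lemma integrable_gaussian {n : ℕ} {b : ℝ} (hb : 0 < b) :
    Integrable (fun z : Cn n => Real.exp (-b * ∑ j, ‖z j‖ ^ 2)) := by
  have h1 : Integrable (fun w : ℂ => Real.exp (-b * ‖w‖ ^ 2)) := by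
    have h := GaussianFourier.integrable_cexp_neg_mul_sq_norm_add (V := ℂ) (b := (b : ℂ))
      (by simpa using hb) 0 0
    refine h.norm.congr (Eventually.of_forall fun w => ?_)
    simp only [Complex.norm_exp]
    norm_cast
    simp
  have h2 := Integrable.fintype_prod (ι := Fin n) (f := fun _ => fun w : ℂ =>
    Real.exp (-b * ‖w‖ ^ 2)) (μ := fun _ => volume) (fun _ => h1)
  refine h2.congr (Eventually.of_forall fun z => ?_)
  simp only [Finset.mul_sum, Real.exp_sum]

lemma lintegral_gaussian_lt_top {n : ℕ} {b : ℝ} (hb : 0 < b) :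
    ∫⁻ z : Cn n, ENNReal.ofReal (Real.exp (-b * ∑ j, ‖z j‖ ^ 2)) < ⊤ := by
  have h := (integrable_gaussian (n := n) hb).hasFiniteIntegral
  rw [hasFiniteIntegral_iff_norm] at h
  simpa only [Real.norm_of_nonneg (Real.exp_pos _).le] using h

lemma lintegral_fWt_lt_top {n : ℕ} : ∫⁻ z : Cn n, ENNReal.ofReal (fWt z) < ⊤ := by
  simpa [fWt] using lintegral_gaussian_lt_top (n := n) one_pos

lemma lintegral_fWt_ne_zero {n : ℕ} : ∫⁻ z : Cn n, ENNReal.ofReal (fWt z) ≠ 0 := by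
  rw [← pos_iff_ne_zero, lintegral_pos_iff_support (by have := continuous_fWt (n := n); fun_prop)]
  have : Function.support (fun z : Cn n => ENNReal.ofReal (fWt z)) = Set.univ := by
    ext z
    simp [fWt_pos z]
  rw [this]
  exact isOpen_univ.measure_pos _ Set.univ_nonempty

/-- The squared Fock norm as an extended nonnegative real. -/
def lNormSq {n : ℕ} (f : Cn n → ℂ) : ENNReal :=
  ∫⁻ z : Cn n, ‖f z‖ₑ ^ 2 * ENNReal.ofReal (fWt z)

lemma enorm_sq_mul_ofReal_fWt {n : ℕ} (f : Cn n → ℂ) (z : Cn n) :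
    ‖f z‖ₑ ^ 2 * ENNReal.ofReal (fWt z) = ENNReal.ofReal (‖f z‖ ^ 2 * fWt z) := by
  rw [ENNReal.ofReal_mul (by positivity), ENNReal.ofReal_pow (norm_nonneg _), ofReal_norm]

lemma memF_iff {n : ℕ} {f : Cn n → ℂ} :
    MemF f ↔ Differentiable ℂ f ∧ lNormSq f < ⊤ := by
  refine and_congr_right fun hf => ?_
  have hc := hf.continuous
  have hw := continuous_fWt (n := n)
  have hm : AEStronglyMeasurable (fun z : Cn n => ‖f z‖ ^ 2 * fWt z) := by fun_prop
  unfold Integrable lNormSq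
  simp only [hm, true_and, enorm_sq_mul_ofReal_fWt]
  rw [hasFiniteIntegral_iff_ofReal]
  exact Eventually.of_forall fun z => mul_nonneg (by positivity) (fWt_pos z).le

lemma fNormSq_eq {n : ℕ} {f : Cn n → ℂ} (hf : Continuous f) :
    fNormSq f = (lNormSq f).toReal := by
  have hw := continuous_fWt (n := n)
  unfold fNormSq lNormSq
  simp only [enorm_sq_mul_ofReal_fWt]
  rw [integral_eq_lintegral_of_nonneg_ae]
  · exact Eventually.of_forall fun z => mul_nonneg (by positivity) (fWt_pos z).le
  · fun_prop

lemma fNormSq_nonneg {n : ℕ} (f : Cn n → ℂ) : 0 ≤ fNormSq f :=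
  integral_nonneg fun z => mul_nonneg (by positivity) (fWt_pos z).le

lemma measurePreserving_smul_of_norm_one {n : ℕ} {c : ℂ} (hc : ‖c‖ = 1) :
    MeasurePreserving (fun z : Cn n => c • z) volume volume := by
  refine volume_preserving_pi (f := fun _ w => c * w) fun _ => ?_
  exact (rotation ⟨c, mem_sphere_zero_iff_norm.2 hc⟩).measurePreserving

lemma fWt_smul_of_norm_one {n : ℕ} {c : ℂ} (hc : ‖c‖ = 1) (z : Cn n) : fWt (c • z) = fWt z := by
  simp [fWt, hc]

lemma enorm_zero_sq_mul_le {n : ℕ} {f : Cn n → ℂ} (hf : Differentiable ℂ f) :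
    ‖f 0‖ₑ ^ 2 * ∫⁻ z : Cn n, ENNReal.ofReal (fWt z) ≤ lNormSq f := by
  have hw := continuous_fWt (n := n)
  have hfc := hf.continuous
  have hfm := hfc.measurable
  have hwm := hw.measurable
  set ν : Measure ℝ := ENNReal.ofReal (2 * Real.pi)⁻¹ •
    volume.restrict (Set.Ioc 0 (2 * Real.pi)) with hν
  have hpi : 0 < 2 * Real.pi := Real.two_pi_pos
  have : IsProbabilityMeasure ν := ⟨by
    simp only [hν, Measure.smul_apply, Measure.restrict_apply_univ, Real.volume_Ioc, sub_zero,
      smul_eq_mul]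
    rw [← ENNReal.ofReal_mul (by positivity), inv_mul_cancel₀ hpi.ne', ENNReal.ofReal_one]⟩
  have hmean (z : Cn n) : ‖f 0‖ₑ ^ 2 ≤ ∫⁻ θ, ‖f (circleMap 0 1 θ • z)‖ₑ ^ 2 ∂ν := by
    have h1 : Differentiable ℂ (fun w : ℂ => f (w • z)) := by fun_prop
    have h2 := (h1.diffContOnCl (s := Metric.ball 0 |1|)).circleAverage
    have h3 : f 0 = ∫ θ, f (circleMap 0 1 θ • z) ∂ν := by
      rw [hν, integral_smul_measure, ENNReal.toReal_ofReal (by positivity)]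
      rw [Real.circleAverage, intervalIntegral.integral_of_le hpi.le] at h2
      rw [h2, zero_smul]
    rw [h3]
    exact enorm_integral_sq_le_lintegral (by
      have := continuous_circleMap 0 1
      fun_prop)
  have hinv (θ : ℝ) :
      ∫⁻ z : Cn n, ‖f (circleMap 0 1 θ • z)‖ₑ ^ 2 * ENNReal.ofReal (fWt z) = lNormSq f := by
    have hθ : ‖circleMap 0 1 θ‖ = 1 := by simp
    have h := (measurePreserving_smul_of_norm_one (n := n) hθ).lintegral_comp
      (f := fun z => ‖f z‖ₑ ^ 2 * ENNReal.ofReal (fWt z)) (by fun_prop)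
    simp only [fWt_smul_of_norm_one hθ] at h
    exact h
  have hcm := (continuous_circleMap 0 1).measurable
  calc ‖f 0‖ₑ ^ 2 * ∫⁻ z : Cn n, ENNReal.ofReal (fWt z)
      = ∫⁻ z : Cn n, ‖f 0‖ₑ ^ 2 * ENNReal.ofReal (fWt z) :=
        (lintegral_const_mul _ (by fun_prop)).symm
    _ ≤ ∫⁻ z : Cn n, ∫⁻ θ, ‖f (circleMap 0 1 θ • z)‖ₑ ^ 2 * ENNReal.ofReal (fWt z) ∂ν := by
        refine lintegral_mono fun z => ?_
        rw [lintegral_mul_const _ (by fun_prop)]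
        gcongr
        exact hmean z
    _ = ∫⁻ θ, (∫⁻ z : Cn n, ‖f (circleMap 0 1 θ • z)‖ₑ ^ 2 * ENNReal.ofReal (fWt z)) ∂ν := by
        refine lintegral_lintegral_swap ?_
        apply Measurable.aemeasurable
        simp only [Function.uncurry_def]
        fun_prop
    _ = lNormSq f := by simp [hinv]

lemma fWt_add {n : ℕ} (z a : Cn n) :
    fWt z * ‖Complex.exp (-∑ j, z j * (starRingEnd ℂ) (a j))‖ ^ 2 =
      Real.exp (∑ j, ‖a j‖ ^ 2) * fWt (z + a) := by
  rw [Complex.norm_exp, ← Real.exp_nat_mul, fWt, fWt, ← Real.exp_add, ← Real.exp_add]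
  congr 1
  have h (j : Fin n) : ‖z j + a j‖ ^ 2 =
      ‖z j‖ ^ 2 + ‖a j‖ ^ 2 + 2 * (z j * (starRingEnd ℂ) (a j)).re := by
    simp only [← Complex.normSq_eq_norm_sq, Complex.normSq_add]
  simp only [Pi.add_apply, h, Finset.sum_add_distrib, Complex.neg_re, Complex.re_sum,
    ← Finset.mul_sum]
  push_cast
  ring

/-- The pointwise bound for functions in the Fock space. -/
lemma enorm_sq_mul_le {n : ℕ} {f : Cn n → ℂ} (hf : Differentiable ℂ f) (a : Cn n) :
    ‖f a‖ₑ ^ 2 * ∫⁻ z : Cn n, ENNReal.ofReal (fWt z) ≤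
      ENNReal.ofReal (Real.exp (∑ j, ‖a j‖ ^ 2)) * lNormSq f := by
  have hw := continuous_fWt (n := n)
  have hfc := hf.continuous
  have hfm := hfc.measurable
  have hwm := hw.measurable
  set F : Cn n → ℂ := fun z => f (z + a) * Complex.exp (-∑ j, z j * (starRingEnd ℂ) (a j)) with hF
  have hFd : Differentiable ℂ F := by
    apply Differentiable.mul (by fun_prop)
    apply Differentiable.cexp
    fun_prop
  have h := enorm_zero_sq_mul_le hFd
  have h0 : F 0 = f a := by simp [hF]
  rw [h0] at h
  refine h.trans (le_of_eq ?_)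
  calc lNormSq F = ∫⁻ z : Cn n, ENNReal.ofReal (Real.exp (∑ j, ‖a j‖ ^ 2)) *
        (‖f (z + a)‖ₑ ^ 2 * ENNReal.ofReal (fWt (z + a))) := by
        refine lintegral_congr fun z => ?_
        rw [enorm_sq_mul_ofReal_fWt, enorm_sq_mul_ofReal_fWt (fun z => f z),
          ← ENNReal.ofReal_mul (Real.exp_pos _).le]
        congr 1
        simp only [hF, norm_mul, mul_pow]
        linear_combination ‖f (z + a)‖ ^ 2 * fWt_add z a
    _ = _ := by
        rw [lintegral_const_mul _ (by fun_prop)]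
        congr 1
        exact lintegral_add_right_eq_self
          (fun z => ‖f z‖ₑ ^ 2 * ENNReal.ofReal (fWt z)) a

lemma exists_enorm_sq_le {n : ℕ} : ∃ C : ENNReal, C ≠ ⊤ ∧ ∀ f : Cn n → ℂ, Differentiable ℂ f →
    ∀ a, ‖f a‖ₑ ^ 2 ≤ C * lNormSq f * ENNReal.ofReal (Real.exp (∑ j, ‖a j‖ ^ 2)) := by
  refine ⟨(∫⁻ z : Cn n, ENNReal.ofReal (fWt z))⁻¹, ENNReal.inv_ne_top.2 lintegral_fWt_ne_zero,
    fun f hf a => ?_⟩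
  have h := enorm_sq_mul_le hf a
  rw [mul_comm, ENNReal.mul_le_iff_le_inv lintegral_fWt_ne_zero lintegral_fWt_lt_top.ne] at h
  refine h.trans (le_of_eq ?_)
  ring

lemma fWt_le_fWt_smul {n : ℕ} {t : ℝ} (h0 : 0 ≤ t) (h1 : t ≤ 1) (z : Cn n) :
    fWt z ≤ fWt ((t : ℂ) • z) := by
  unfold fWt
  gcongr with j
  simp only [Pi.smul_apply, smul_eq_mul, norm_mul, Complex.norm_real, Real.norm_of_nonneg h0]
  exact mul_le_of_le_one_left (norm_nonneg _) h1

lemma lintegral_comp_smul_le {n : ℕ} {F : Cn n → ENNReal} (hF : Measurable F) {t : ℝ}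
    (ht : 1 / 2 ≤ t) : ∫⁻ z : Cn n, F ((t : ℂ) • z) ≤ 4 ^ n * ∫⁻ z, F z := by
  have ht0 : 0 < t := by linarith
  have h := Measure.map_addHaar_smul (volume : Measure (Cn n)) ht0.ne'
  have hdim : Module.finrank ℝ (Cn n) = 2 * n := by
    rw [Module.finrank_pi_fintype]
    simp [Complex.finrank_real_complex, mul_comm]
  have h2 : ∫⁻ z : Cn n, F ((t : ℂ) • z) =
      ∫⁻ z, F z ∂(Measure.map (t • ·) (volume : Measure (Cn n))) := by
    rw [lintegral_map hF (by fun_prop)]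
    rfl
  rw [h2, h, lintegral_smul_measure, smul_eq_mul]
  gcongr
  rw [hdim, abs_of_pos (by positivity), show (4 : ENNReal) ^ n = ENNReal.ofReal (4 ^ n) by
    rw [ENNReal.ofReal_pow (by norm_num)]; norm_num]
  apply ENNReal.ofReal_le_ofReal
  rw [pow_mul, ← inv_pow]
  gcongr
  rw [inv_le_comm₀ (by positivity) (by norm_num)]
  nlinarith

/-- If `(E + p) f i = g i` with `g i` bounded in the Fock space and pointwise null, then
`f i` tends to zero in norm. -/
lemma tendsto_lNormSq_zero_of_euler {n p : ℕ} (hp : 1 ≤ p) {f g : ℕ → Cn n → ℂ}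
    (hf : ∀ i, Differentiable ℂ (f i)) (hg : ∀ i, Differentiable ℂ (g i))
    (hfg : ∀ i z, fderiv ℂ (f i) z z + p * f i z = g i z) {B : ENNReal} (hB : B ≠ ⊤)
    (hgB : ∀ i, lNormSq (g i) ≤ B) (hlim : ∀ z, Tendsto (fun i => g i z) atTop (nhds 0)) :
    Tendsto (fun i => lNormSq (f i)) atTop (nhds 0) := by
  have hwm := (continuous_fWt (n := n)).measurable
  have hgm (i : ℕ) : Measurable (g i) := (hg i).continuous.measurable
  obtain ⟨C, hC, hCb⟩ := exists_enorm_sq_le (n := n)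
  set Φ : ℕ → ℝ → ENNReal := fun i t =>
    ∫⁻ z : Cn n, ‖g i ((t : ℂ) • z)‖ₑ ^ 2 * ENNReal.ofReal (fWt z)
  have hjoint (i : ℕ) : Measurable (fun q : Cn n × ℝ =>
      ‖g i ((q.2 : ℂ) • q.1)‖ₑ ^ 2 * ENNReal.ofReal (fWt q.1)) := by
    have h1 : Measurable (fun q : Cn n × ℝ => (q.2 : ℂ) • q.1) :=
      Continuous.measurable (by fun_prop)
    have h2 := (hgm i).comp h1
    exact (h2.enorm.pow_const 2).mul (hwm.comp measurable_fst).ennreal_ofReal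
  have hle (i : ℕ) : lNormSq (f i) ≤ ∫⁻ t in Set.Ioo (0 : ℝ) 1, Φ i t := by
    calc lNormSq (f i) ≤ ∫⁻ z : Cn n, ∫⁻ t in Set.Ioo (0 : ℝ) 1,
          ‖g i ((t : ℂ) • z)‖ₑ ^ 2 * ENNReal.ofReal (fWt z) := by
          refine lintegral_mono fun z => ?_
          rw [lintegral_mul_const' _ _ ENNReal.ofReal_ne_top]
          gcongr
          exact enorm_sq_le_lintegral_of_euler hp (hf i) (hg i).continuous (hfg i) z
      _ = _ := lintegral_lintegral_swap (hjoint i).aemeasurable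
  have hΦm (i : ℕ) : Measurable (Φ i) := (hjoint i).lintegral_prod_left'
  have hpt (i : ℕ) (t : ℝ) (z : Cn n) (b : ℝ) (hb : t ^ 2 ≤ 1 - b) :
      ‖g i ((t : ℂ) • z)‖ₑ ^ 2 * ENNReal.ofReal (fWt z) ≤
        C * B * ENNReal.ofReal (Real.exp (-b * ∑ j, ‖z j‖ ^ 2)) := by
    calc _ ≤ C * B * ENNReal.ofReal (Real.exp (∑ j, ‖((t : ℂ) • z) j‖ ^ 2)) *
          ENNReal.ofReal (fWt z) := by
          gcongr
          exact (hCb _ (hg i) _).trans (by gcongr; exact hgB i)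
      _ ≤ _ := by
          rw [mul_assoc, ← ENNReal.ofReal_mul (Real.exp_pos _).le, fWt, ← Real.exp_add]
          gcongr
          simp only [Pi.smul_apply, smul_eq_mul, norm_mul, Complex.norm_real, mul_pow,
            Real.norm_eq_abs, sq_abs, ← Finset.mul_sum]
          have : 0 ≤ ∑ j, ‖z j‖ ^ 2 := by positivity
          nlinarith
  have hCB : C * B ≠ ⊤ := ENNReal.mul_ne_top hC hB
  have hgauss (b : ℝ) (hb : 0 < b) :
      ∫⁻ z : Cn n, C * B * ENNReal.ofReal (Real.exp (-b * ∑ j, ‖z j‖ ^ 2)) ≠ ⊤ := by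
    rw [lintegral_const_mul' _ _ hCB]
    exact ENNReal.mul_ne_top hCB (lintegral_gaussian_lt_top hb).ne
  have hΦlim : ∀ t ∈ Set.Ioo (0 : ℝ) 1, Tendsto (fun i => Φ i t) atTop (nhds 0) := by
    intro t ht
    have ht2 : t ^ 2 < 1 := by nlinarith [ht.1, ht.2]
    have h := tendsto_lintegral_of_dominated_convergence (μ := (volume : Measure (Cn n)))
      (F := fun i z => ‖g i ((t : ℂ) • z)‖ₑ ^ 2 * ENNReal.ofReal (fWt z)) (f := fun _ => 0)
      (fun z => C * B * ENNReal.ofReal (Real.exp (-(1 - t ^ 2) * ∑ j, ‖z j‖ ^ 2)))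
      (fun i => (hjoint i).comp (measurable_id.prodMk measurable_const))
      (fun i => Eventually.of_forall fun z => hpt i t z _ (by linarith))
      (hgauss _ (by linarith))
      (Eventually.of_forall fun z => by
        have h1 := (hlim ((t : ℂ) • z)).enorm
        have h2 := ((ENNReal.continuous_pow 2).tendsto _).comp h1
        have h3 := ENNReal.Tendsto.mul_const (b := ENNReal.ofReal (fWt z)) h2
          (Or.inr ENNReal.ofReal_ne_top)
        simpa using h3)
    rw [lintegral_zero] at h
    exact h
  set M : ENNReal := ∫⁻ z : Cn n, C * B * ENNReal.ofReal (Real.exp (-(3 / 4) * ∑ j, ‖z j‖ ^ 2))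
  have hΦb (i : ℕ) : ∀ t ∈ Set.Ioo (0 : ℝ) 1, Φ i t ≤ M + 4 ^ n * B := by
    intro t ht
    rcases le_total t (1 / 2) with h | h
    · exact (lintegral_mono fun z => hpt i t z (3 / 4) (by nlinarith [ht.1])).trans le_self_add
    · refine le_trans ?_ le_add_self
      calc Φ i t ≤ ∫⁻ z : Cn n, ‖g i ((t : ℂ) • z)‖ₑ ^ 2 *
            ENNReal.ofReal (fWt ((t : ℂ) • z)) := by
            refine lintegral_mono fun z => ?_
            dsimp only
            gcongr
            exact fWt_le_fWt_smul ht.1.le ht.2.le z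
        _ ≤ 4 ^ n * lNormSq (g i) := lintegral_comp_smul_le
            (((hgm i).enorm.pow_const 2).mul hwm.ennreal_ofReal) h
        _ ≤ _ := by gcongr; exact hgB i
  have hfin : ∫⁻ _ in Set.Ioo (0 : ℝ) 1, (M + 4 ^ n * B) ≠ ⊤ := by
    have hM : M ≠ ⊤ := hgauss _ (by norm_num)
    simp [hM, ENNReal.mul_ne_top, hB]
  have h := tendsto_lintegral_of_dominated_convergence
    (μ := volume.restrict (Set.Ioo (0 : ℝ) 1)) (F := Φ) (f := fun _ => 0)
    (fun _ => M + 4 ^ n * B) hΦm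
    (fun i => (ae_restrict_iff' measurableSet_Ioo).2 (Eventually.of_forall (hΦb i))) hfin
    ((ae_restrict_iff' measurableSet_Ioo).2 (Eventually.of_forall hΦlim))
  rw [lintegral_zero] at h
  exact tendsto_of_tendsto_of_tendsto_of_le_of_le tendsto_const_nhds h (fun _ => zero_le) hle

section LocallyBounded

variable {E : Type*} [NormedAddCommGroup E] [NormedSpace ℂ E]

lemma norm_fderiv_le_of_norm_le {f : E → ℂ} (hf : Differentiable ℂ f) {a : E} {M : ℝ}
    (hM : ∀ y ∈ Metric.ball a 1, ‖f y‖ ≤ M) : ‖fderiv ℂ f a‖ ≤ 2 * M := by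
  have h := Complex.norm_fderiv_le_div_of_mapsTo_ball (R₁ := 1) (R₂ := 2 * M) (c := a)
    hf.differentiableOn (fun y hy => by
      rw [Metric.mem_closedBall, dist_eq_norm]
      have h1 := hM y hy
      have h2 := hM a (Metric.mem_ball_self one_pos)
      linarith [norm_sub_le (f y) (f a)]) one_pos
  simpa using h

lemma dist_le_of_norm_le {f : E → ℂ} (hf : Differentiable ℂ f) {a : E} {M : ℝ}
    (hM : ∀ y ∈ Metric.ball a 1, ‖f y‖ ≤ M) {y : E} (hy : y ∈ Metric.ball a 1) :
    dist (f y) (f a) ≤ 2 * M * dist y a := by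
  have h := Complex.dist_le_div_mul_dist_of_mapsTo_ball (R₁ := 1) (R₂ := 2 * M) (c := a)
    hf.differentiableOn (fun y hy => by
      rw [Metric.mem_closedBall, dist_eq_norm]
      have h1 := hM y hy
      have h2 := hM a (Metric.mem_ball_self one_pos)
      linarith [norm_sub_le (f y) (f a)]) hy
  simpa using h

lemma differentiable_of_tendstoLocallyUniformly [ProperSpace E] {F : ℕ → E → ℂ} {G : E → ℂ}
    (hF : ∀ i, Differentiable ℂ (F i)) (h : TendstoLocallyUniformly F G atTop) :
    Differentiable ℂ G := by
  intro x
  have hu : UniformCauchySeqOn F atTop (Metric.closedBall x 2) :=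
    (tendstoLocallyUniformly_iff_forall_isCompact.1 h _
      (isCompact_closedBall x 2)).uniformCauchySeqOn
  have hd : UniformCauchySeqOn (fun i => fderiv ℂ (F i)) atTop (Metric.ball x 1) := by
    rw [Metric.uniformCauchySeqOn_iff] at hu ⊢
    intro ε hε
    obtain ⟨N, hN⟩ := hu (ε / 3) (by positivity)
    refine ⟨N, fun i hi j hj y hy => ?_⟩
    have h1 : ‖fderiv ℂ (F i - F j) y‖ ≤ 2 * (ε / 3) := by
      refine norm_fderiv_le_of_norm_le ((hF i).sub (hF j)) fun w hw => ?_
      have := hN i hi j hj w (by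
        rw [Metric.mem_ball] at hy hw
        rw [Metric.mem_closedBall]
        linarith [dist_triangle w y x])
      rw [dist_eq_norm] at this
      exact this.le
    rw [fderiv_sub (hF i y) (hF j y)] at h1
    rw [dist_eq_norm]
    linarith
  have hlim : ∀ y ∈ Metric.ball x 1, ∃ L, Tendsto (fun i => fderiv ℂ (F i) y) atTop (nhds L) :=
    fun y hy => cauchySeq_tendsto_of_complete (hd.cauchySeq hy)
  choose! L hL using hlim
  exact (hasFDerivAt_of_tendstoUniformlyOn Metric.isOpen_ball
    (hd.tendstoUniformlyOn_of_tendsto hL) (fun i y _ => (hF i y).hasFDerivAt)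
    (fun y _ => (tendstoLocallyUniformlyOn_univ.2 h).tendsto_at (Set.mem_univ y))
    (Metric.mem_ball_self one_pos)).differentiableAt

/-- Montel's theorem for finitely many simultaneous sequences of entire functions, in the form of
pointwise convergence to an entire limit. -/
lemma exists_subseq_tendsto_of_locally_bounded [ProperSpace E] {ι : Type*} [Finite ι]
    {F : ℕ → ι → E → ℂ} (hF : ∀ i k, Differentiable ℂ (F i k))
    (hb : ∀ a, ∃ M : ℝ, ∀ i k, ∀ z ∈ Metric.ball a 1, ‖F i k z‖ ≤ M) :
    ∃ φ : ℕ → ℕ, StrictMono φ ∧ ∃ G : ι → E → ℂ, (∀ k, Differentiable ℂ (G k)) ∧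
      ∀ k z, Tendsto (fun i => F (φ i) k z) atTop (nhds (G k z)) := by
  choose M hM using hb
  set P : (E → ℂ) → Prop := fun f => ∀ a, ‖f a‖ ≤ M a ∧
    ∀ y ∈ Metric.ball a 1, dist (f y) (f a) ≤ 2 * M a * dist y a with hP
  set S : Set C(E, ℂ) := {f | P f}
  have hequi : ∀ {T : Type _} (f : T → E → ℂ), (∀ t, P (f t)) → Equicontinuous f := by
    intro T f hf a
    refine Metric.equicontinuousAt_of_continuity_modulus (fun y => 2 * M a * dist a y) ?_ f ?_
    · have : Continuous fun y => 2 * M a * dist a y := by fun_prop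
      simpa using this.tendsto a
    · filter_upwards [Metric.ball_mem_nhds a one_pos] with y hy t
      rw [dist_comm, dist_comm a y]
      exact (hf t a).2 y hy
  have hSc : IsCompact S := by
    refine ArzelaAscoli.isCompact_of_equicontinuous S ?_ (hequi _ fun f => f.2)
    have himg : ContinuousMap.toFun '' S = {f | P f} := by
      ext f
      constructor
      · rintro ⟨g, hg, rfl⟩
        exact hg
      · intro hf
        exact ⟨⟨f, (hequi (fun _ : PUnit => f) fun _ => (show P f from hf)).continuous ⟨⟩⟩, hf, rfl⟩
    rw [himg]
    refine IsCompact.of_isClosed_subset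
      (isCompact_univ_pi fun a => isCompact_closedBall (0 : ℂ) (M a)) ?_ ?_
    · simp only [hP, Set.ofPred_forall, Set.ofPred_and]
      refine isClosed_iInter fun a => IsClosed.inter ?_ ?_
      · exact isClosed_le (by fun_prop) (by fun_prop)
      · exact isClosed_iInter fun y => isClosed_iInter fun _ =>
          isClosed_le (by fun_prop) (by fun_prop)
    · intro f hf a _
      simpa using (hf a).1
  set Fc : ℕ → ι → C(E, ℂ) := fun i k => ⟨F i k, (hF i k).continuous⟩
  have hmem (i : ℕ) : Fc i ∈ Set.univ.pi fun _ : ι => S := fun k _ a =>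
    ⟨hM a i k a (Metric.mem_ball_self one_pos), fun y hy =>
      dist_le_of_norm_le (hF i k) (hM a i k) hy⟩
  obtain ⟨G, -, φ, hφ, hG⟩ := (isCompact_univ_pi fun _ : ι => hSc).tendsto_subseq hmem
  have hloc (k : ι) : TendstoLocallyUniformly (fun i => F (φ i) k) (G k) atTop :=
    ContinuousMap.tendsto_iff_tendstoLocallyUniformly.1 (tendsto_pi_nhds.1 hG k)
  exact ⟨φ, hφ, fun k => G k, fun k =>
    differentiable_of_tendstoLocallyUniformly (fun i => hF _ k) (hloc k),
    fun k z => (tendstoLocallyUniformlyOn_univ.2 (hloc k)).tendsto_at (Set.mem_univ z)⟩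

end LocallyBounded

lemma lNormSq_le_one {n : ℕ} {u : FormC n} (hu : MemA2 u) (h : formNormSq u ≤ 1)
    (J : Finset (Fin n)) : lNormSq (u J) ≤ 1 := by
  obtain ⟨hd, hfin⟩ := memF_iff.1 (hu J)
  have h1 : fNormSq (u J) ≤ 1 :=
    (Finset.single_le_sum (f := fun J => fNormSq (u J)) (fun J _ => fNormSq_nonneg (u J))
      (Finset.mem_univ J)).trans h
  rw [fNormSq_eq hd.continuous] at h1
  rw [← ENNReal.ofReal_toReal hfin.ne]
  exact ENNReal.ofReal_le_one.2 h1

lemma lNormSq_sub_le {n : ℕ} {f g : Cn n → ℂ} (hf : Continuous f) :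
    lNormSq (fun z => f z - g z) ≤ 2 * (lNormSq f + lNormSq g) := by
  have hwm := (continuous_fWt (n := n)).measurable
  have hfm := hf.measurable
  unfold lNormSq
  rw [← lintegral_add_left (by fun_prop), ← lintegral_const_mul' _ _ (by norm_num)]
  refine lintegral_mono fun z => ?_
  rw [← add_mul, ← mul_assoc]
  gcongr
  calc ‖f z - g z‖ₑ ^ 2 ≤ (‖f z‖ₑ + ‖g z‖ₑ) ^ 2 := by gcongr; exact enorm_sub_le
    _ ≤ 2 * (‖f z‖ₑ ^ 2 + ‖g z‖ₑ ^ 2) := by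
      simp only [enorm_eq_nnnorm]
      exact_mod_cast add_sq_le (a := ‖f z‖₊) (b := ‖g z‖₊)

lemma lNormSq_le_of_tendsto {n : ℕ} {f : ℕ → Cn n → ℂ} {g : Cn n → ℂ}
    (hf : ∀ i, Continuous (f i)) {B : ENNReal} (hB : ∀ i, lNormSq (f i) ≤ B)
    (hlim : ∀ z, Tendsto (fun i => f i z) atTop (nhds (g z))) : lNormSq g ≤ B := by
  have hwm := (continuous_fWt (n := n)).measurable
  have hfm (i : ℕ) := (hf i).measurable
  have h (z : Cn n) : ‖g z‖ₑ ^ 2 * ENNReal.ofReal (fWt z) =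
      liminf (fun i => ‖f i z‖ₑ ^ 2 * ENNReal.ofReal (fWt z)) atTop := by
    refine (Tendsto.liminf_eq ?_).symm
    refine ENNReal.Tendsto.mul_const ?_ (Or.inr ENNReal.ofReal_ne_top)
    exact ((ENNReal.continuous_pow 2).tendsto _).comp (hlim z).enorm
  unfold lNormSq
  simp only [h]
  refine (lintegral_liminf_le fun i => by fun_prop).trans ?_
  exact liminf_le_of_le (by isBoundedDefault) fun b hb => by
    obtain ⟨i, hi⟩ := hb.exists
    exact hi.trans (hB i)

lemma exists_locally_bounded {n : ℕ} (a : Cn n) : ∃ M : ℝ, ∀ f : Cn n → ℂ, Differentiable ℂ f →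
    lNormSq f ≤ 1 → ∀ z ∈ Metric.ball a 1, ‖f z‖ ≤ M := by
  obtain ⟨C, hC, hCb⟩ := exists_enorm_sq_le (n := n)
  refine ⟨√(C.toReal * Real.exp (∑ _j : Fin n, (‖a‖ + 1) ^ 2)), fun f hf h1 z hz => ?_⟩
  apply Real.le_sqrt_of_sq_le
  have hza : ‖z‖ ≤ ‖a‖ + 1 := by
    rw [Metric.mem_ball, dist_eq_norm] at hz
    linarith [norm_sub_norm_le z a]
  have h : ‖f z‖ₑ ^ 2 ≤ C * ENNReal.ofReal (Real.exp (∑ _j : Fin n, (‖a‖ + 1) ^ 2)) := by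
    refine (hCb f hf z).trans ?_
    gcongr with j
    · exact mul_le_of_le_one_right zero_le h1
    · exact (norm_le_pi_norm z j).trans hza
  have h2 := ENNReal.toReal_mono (ENNReal.mul_ne_top hC ENNReal.ofReal_ne_top) h
  simpa [ENNReal.toReal_ofReal (Real.exp_pos _).le] using h2

/-- The operator `Ñ_p : A²_{(p,0)} → A²_{(p,0)}`, `1 ≤ p ≤ n`, is compact: the
image of any sequence in the unit ball has a subsequence converging in norm. -/
theorem stmt15 {n p : ℕ} (hp : 1 ≤ p) (hpn : p ≤ n)
    (N : FormC n → FormC n) (hN : IsInvBox p N)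
    (v : ℕ → FormC n)
    (hv : ∀ i, IsDeg p (v i) ∧ MemA2 (v i) ∧ formNormSq (v i) ≤ 1) :
    ∃ φ : ℕ → ℕ, StrictMono φ ∧ ∃ w : FormC n, IsDeg p w ∧ MemA2 w ∧
      Tendsto (fun i => formNormSq (fun J z => N (v (φ i)) J z - w J z))
        atTop (nhds 0) := by
  obtain ⟨φ, hφ, V, hVd, hVlim⟩ := exists_subseq_tendsto_of_locally_bounded (F := v)
    (fun i J => ((hv i).2.1 J).1) (fun a => by
      obtain ⟨M, hM⟩ := exists_locally_bounded a
      exact ⟨M, fun i J => hM _ ((hv i).2.1 J).1 (lNormSq_le_one (hv i).2.1 (hv i).2.2 J)⟩)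
  have hVdeg : IsDeg p V := by
    intro J hJ
    ext z
    refine tendsto_nhds_unique (hVlim J z) ?_
    simp [(hv _).1 J hJ]
  have hv1 (i : ℕ) (J : Finset (Fin n)) : lNormSq (v i J) ≤ 1 :=
    lNormSq_le_one (hv i).2.1 (hv i).2.2 J
  have hV1 (J : Finset (Fin n)) : lNormSq (V J) ≤ 1 :=
    lNormSq_le_of_tendsto (fun i => ((hv (φ i)).2.1 J).1.continuous) (fun i => hv1 (φ i) J)
      (hVlim J)
  have hVmem : MemA2 V := fun J => memF_iff.2 ⟨hVd J, (hV1 J).trans_lt ENNReal.one_lt_top⟩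
  obtain ⟨hwdeg, hwdom, hwbox⟩ := (hN V hVdeg hVmem).1
  have hw : MemA2 (N V) := hwdom.1.1
  have hNv (i : ℕ) := (hN (v i) (hv i).1 (hv i).2.1).1
  have hu (i : ℕ) : MemA2 (N (v i)) := (hNv i).2.1.1.1
  refine ⟨φ, hφ, N V, hwdeg, hw, ?_⟩
  unfold formNormSq
  rw [← Finset.sum_const_zero (s := (Finset.univ : Finset (Finset (Fin n))))]
  refine tendsto_finsetSum _ fun J _ => ?_
  have hdiff (i : ℕ) : Differentiable ℂ (fun z => N (v (φ i)) J z - N V J z) :=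
    (hu _ J).1.sub (hw J).1
  by_cases hJ : J.card = p
  · have key := tendsto_lNormSq_zero_of_euler hp (B := 2 * (1 + 1))
      (g := fun i z => v (φ i) J z - V J z) hdiff
      (fun i => ((hv _).2.1 J).1.sub (hVd J))
      (fun i z => by
        have h1 := boxOp_apply (fun J => (hu (φ i) J).1) J z
        have h2 := boxOp_apply (fun J => (hw J).1) J z
        rw [(hNv (φ i)).2.2, hJ] at h1
        rw [hwbox, hJ] at h2
        rw [fderiv_fun_sub ((hu _ J).1 z) ((hw J).1 z), _root_.sub_apply, h1, h2]
        ring) (by finiteness)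
      (fun i => (lNormSq_sub_le ((hv _).2.1 J).1.continuous).trans
        (by gcongr; exacts [hv1 _ J, hV1 J]))
      (fun z => by simpa using (hVlim J z).sub_const (V J z))
    simp only [fun i => fNormSq_eq (hdiff i).continuous]
    simpa [Function.comp_def] using (ENNReal.tendsto_toReal ENNReal.zero_ne_top).comp key
  · simp [fNormSq, hwdeg J hJ, (hNv _).1 J hJ]
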